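/- Let n ≥ 1 and let r ≥ 0 be even. For every k ≥ 0, the dimension of the real vector space C^r_k(AS(Δ_n)) of splines of smoothness r and degree at most k on the Alfeld split of the n-simplex is binom(k+n, n) + Σ_{j=1}^{n} binom(k + n − j − r(n+1)/2, n), with the convention that binom(a, n) = 0 whenever a < n. -/

import Mathlib

open MvPolynomial

noncomputable section

/-- The `i`-th maximal simplex `σ_i = conv({v} ∪ {e_j : j ≠ i})` of the Alfeld split
`AS(Δ_n)` of the simplex `Δ_n = conv{e_0, …, e_n}` with interior split point `v`. -/
def alfeldCell {n : ℕ} (e : Fin (n + 1) → Fin n → ℝ) (v : Fin n → ℝ) (i : Fin (n + 1)) :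
    Set (Fin n → ℝ) :=
  convexHull ℝ ({v} ∪ e '' {j | j ≠ i})

/-- The space `C^r_k(AS(Δ_n))` of splines on the Alfeld split: functions on
`Δ_n = conv{e_0, …, e_n}` that are `r` times continuously differentiable on `Δ_n` and agree on
each maximal simplex `σ_i` with a polynomial of total degree at most `k`. -/
def alfeldSplines (n r k : ℕ) (e : Fin (n + 1) → Fin n → ℝ) (v : Fin n → ℝ) :
    Submodule ℝ ((convexHull ℝ (Set.range e) : Set (Fin n → ℝ)) → ℝ) where
  carrier := { f | ∃ F : (Fin n → ℝ) → ℝ,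
      ContDiffOn ℝ r F (convexHull ℝ (Set.range e)) ∧
      (∀ x : (convexHull ℝ (Set.range e) : Set (Fin n → ℝ)), f x = F ↑x) ∧
      ∀ i : Fin (n + 1), ∃ p : MvPolynomial (Fin n) ℝ,
        p.totalDegree ≤ k ∧ ∀ x ∈ alfeldCell e v i, F x = eval x p }
  add_mem' := by
    rintro f g ⟨F, hF, hfF, hFp⟩ ⟨G, hG, hgG, hGp⟩
    refine ⟨F + G, hF.add hG, fun x => by simp [hfF x, hgG x], fun i => ?_⟩
    obtain ⟨p, hp, hpe⟩ := hFp i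
    obtain ⟨q, hq, hqe⟩ := hGp i
    exact ⟨p + q, le_trans (MvPolynomial.totalDegree_add p q) (max_le hp hq),
      fun x hx => by simp [hpe x hx, hqe x hx]⟩
  zero_mem' :=
    ⟨0, contDiffOn_const, fun x => rfl, fun i => ⟨0, by simp, fun x hx => by simp⟩⟩
  smul_mem' := by
    rintro c f ⟨F, hF, hfF, hFp⟩
    refine ⟨c • F, hF.const_smul c, fun x => by simp [hfF x], fun i => ?_⟩
    obtain ⟨p, hp, hpe⟩ := hFp i
    exact ⟨c • p, le_trans (MvPolynomial.totalDegree_smul_le c p) hp,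
      fun x hx => by simp [hpe x hx, MvPolynomial.smul_eq_C_mul]⟩


open scoped ContDiff in
/-- A function which agrees with smooth functions `p i` on the members of a finite closed cover is
`C^r` as soon as `p i - p j` is a multiple of the `(r + 1)`-st power of a function vanishing on
the intersection of the `i`-th and `j`-th members. -/
theorem contDiff_of_piecewise {ι E : Type} [Finite ι] [NormedAddCommGroup E] [NormedSpace ℝ E]
    {A : ι → Set E} (hA : ∀ i, IsClosed (A i)) (hcov : ∀ x, ∃ i, x ∈ A i)
    {l : ι → ι → E → ℝ} (hl : ∀ i j, ContDiff ℝ ∞ (l i j))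
    (hl0 : ∀ i j, ∀ x ∈ A i, x ∈ A j → l i j x = 0) (r : ℕ) :
    ∀ {F : Type} [NormedAddCommGroup F] [NormedSpace ℝ F] {f : E → F} {p : ι → E → F},
      (∀ i, ContDiff ℝ ∞ (p i)) → (∀ i, ∀ x ∈ A i, f x = p i x) →
      (∀ i j, ∃ h : E → F, ContDiff ℝ ∞ h ∧ ∀ x, p i x - p j x = l i j x ^ (r + 1) • h x) →
      ContDiff ℝ r f := by
  induction r with
  | zero =>
    intro F _ _ f p hp hf _
    refine contDiff_zero.2 ((locallyFinite_of_finite A).continuous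
      (Set.iUnion_eq_univ_iff.2 hcov) hA fun i => ?_)
    exact (hp i).continuous.continuousOn.congr (hf i)
  | succ r ih =>
    intro F _ _ f p hp hf hdiv
    choose c hc using hcov
    have hdiv' : ∀ i j, ∃ h : E → E →L[ℝ] F, ContDiff ℝ ∞ h ∧
        ∀ x, fderiv ℝ (p i) x - fderiv ℝ (p j) x = l i j x ^ (r + 1) • h x := by
      intro i j
      obtain ⟨h, hh, hpq⟩ := hdiv i j
      refine ⟨fun x => l i j x • fderiv ℝ h x +
        ((r : ℝ) + 2) • (fderiv ℝ (l i j) x).smulRight (h x), ?_, fun x => ?_⟩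
      · have h1 : ContDiff ℝ ∞ (fderiv ℝ h) := hh.fderiv_right (by simp)
        have h2 : ContDiff ℝ ∞ (fderiv ℝ (l i j)) := (hl i j).fderiv_right (by simp)
        exact ((hl i j).smul h1).add ((h2.smulRight hh).const_smul _)
      · have hd : ∀ {G : Type} [NormedAddCommGroup G] [NormedSpace ℝ G] {q : E → G},
            ContDiff ℝ ∞ q → HasFDerivAt q (fderiv ℝ q x) x := fun hq =>
          (hq.differentiable (by simp)).differentiableAt.hasFDerivAt
        have e1 := (hd (hp i)).sub (hd (hp j))
        have e2 := ((hd (hl i j)).pow (r + 1 + 1)).smul (hd hh)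
        have e3 : (p i - p j) = (fun x => l i j x ^ (r + 1 + 1) • h x) := funext hpq
        rw [e3] at e1
        rw [e1.unique e2]
        ext y
        simp only [smul_add, _root_.add_apply, _root_.smul_apply,
          ContinuousLinearMap.smulRight_apply, smul_smul, pow_succ, smul_eq_mul]
        push_cast
        congr 2
        simp only [nsmul_eq_mul]
        push_cast
        ring
    have heq : ∀ i, ∀ x ∈ A i, fderiv ℝ (p (c x)) x = fderiv ℝ (p i) x := by
      intro i x hx
      obtain ⟨h, -, hh⟩ := hdiv' (c x) i
      rw [← sub_eq_zero, hh, hl0 _ _ _ (hc x) hx]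
      simp
    rw [Nat.cast_add, Nat.cast_one, contDiff_succ_iff_hasFDerivAt]
    refine ⟨fun x => fderiv ℝ (p (c x)) x, ih (p := fun i => fderiv ℝ (p i))
      (fun i => (hp i).fderiv_right (by simp)) heq hdiv', fun x => ?_⟩
    have hw : ∀ i, HasFDerivWithinAt f (fderiv ℝ (p (c x)) x) (A i) x := by
      intro i
      by_cases hx : x ∈ A i
      · rw [heq i x hx]
        exact (((hp i).differentiable (by simp)).differentiableAt.hasFDerivAt.hasFDerivWithinAt
          (s := A i)).congr (hf i) (hf i x hx)
      · exact .of_notMem_closure (by rwa [(hA i).closure_eq])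
    rw [← hasFDerivWithinAt_univ, ← Set.iUnion_eq_univ_iff.2 fun x => ⟨c x, hc x⟩]
    simp only [hasFDerivWithinAt_iff_isLittleO, nhdsWithin_iUnion, Asymptotics.isLittleO_iff,
      Filter.eventually_iSup] at hw ⊢
    exact fun _ hε i => hw i hε

theorem Polynomial.X_pow_dvd_sub_of_contDiffAt {r : ℕ} : ∀ {g : ℝ → ℝ} {P Q : Polynomial ℝ},
    ContDiffAt ℝ r g 0 → (∀ᶠ t in nhdsWithin 0 (Set.Ioi 0), g t = P.eval t) →
    (∀ᶠ t in nhdsWithin 0 (Set.Iio 0), g t = Q.eval t) →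
    (Polynomial.X : Polynomial ℝ) ^ (r + 1) ∣ P - Q := by
  have key : ∀ {g : ℝ → ℝ} {P Q : Polynomial ℝ},
    ContinuousAt g 0 → (∀ᶠ t in nhdsWithin 0 (Set.Ioi 0), g t = P.eval t) →
    (∀ᶠ t in nhdsWithin 0 (Set.Iio 0), g t = Q.eval t) → (P - Q).coeff 0 = 0 := by
    intro g P Q hg hP hQ
    have h1 : g 0 = P.eval 0 := tendsto_nhds_unique (hg.tendsto.mono_left nhdsWithin_le_nhds)
      ((P.continuous.continuousAt.tendsto.mono_left nhdsWithin_le_nhds).congr'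
        (hP.mono fun t ht => ht.symm))
    have h2 : g 0 = Q.eval 0 := tendsto_nhds_unique (hg.tendsto.mono_left nhdsWithin_le_nhds)
      ((Q.continuous.continuousAt.tendsto.mono_left nhdsWithin_le_nhds).congr'
        (hQ.mono fun t ht => ht.symm))
    rw [Polynomial.coeff_zero_eq_eval_zero, Polynomial.eval_sub, ← h1, ← h2, sub_self]
  induction r with
  | zero =>
    intro g P Q hg hP hQ
    rw [zero_add, pow_one, Polynomial.X_dvd_iff]
    exact key hg.continuousAt hP hQ
  | succ r ih =>
    intro g P Q hg hP hQ
    have hd : ∀ {s : Set ℝ} {R : Polynomial ℝ}, IsOpen s →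
        (∀ᶠ t in nhdsWithin 0 s, g t = R.eval t) →
        ∀ᶠ t in nhdsWithin 0 s, deriv g t = R.derivative.eval t := by
      intro s R hs hR
      filter_upwards [eventually_eventually_nhdsWithin.2 hR, self_mem_nhdsWithin] with t ht hts
      rw [hs.nhdsWithin_eq hts] at ht
      rw [Filter.EventuallyEq.deriv_eq ht, Polynomial.deriv]
    have h := ih (g := deriv g) (ContDiffAt.derivWithin hg (by simp))
      (hd isOpen_Ioi hP) (hd isOpen_Iio hQ)
    rw [← Polynomial.derivative_sub, Polynomial.X_pow_dvd_iff] at h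
    rw [Polynomial.X_pow_dvd_iff]
    rintro (_ | d) hd'
    · exact key hg.continuousAt hP hQ
    · have := h d (by omega)
      rw [Polynomial.coeff_derivative] at this
      exact (mul_eq_zero.1 this).resolve_right (by positivity)

namespace MvPolynomial

variable {σ : Type}

theorem totalDegree_eq_one_of_eval_add_smul {l : MvPolynomial σ ℝ} {u : σ → ℝ}
    (hdeg : l.totalDegree ≤ 1)
    (hl : ∀ (x : σ → ℝ) (t : ℝ), eval (x + t • u) l = eval x l + t) : l.totalDegree = 1 := by
  refine le_antisymm hdeg (Nat.one_le_iff_ne_zero.2 fun h0 => ?_)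
  rw [totalDegree_eq_zero_iff_eq_C] at h0
  have := hl 0 1
  rw [h0] at this
  simp at this

theorem irreducible_of_totalDegree_eq_one' {l : MvPolynomial σ ℝ} (hdeg : l.totalDegree = 1) :
    Irreducible l := by
  refine irreducible_of_totalDegree_eq_one hdeg fun x hx => isUnit_iff_ne_zero.2 ?_
  rintro rfl
  have : l = 0 := by
    ext i
    simpa using hx i
  simp [this] at hdeg

theorem totalDegree_finsetProd_of_ne_zero {ι : Type} {s : Finset ι} {f : ι → MvPolynomial σ ℝ}
    (h : ∀ i ∈ s, f i ≠ 0) : (∏ i ∈ s, f i).totalDegree = ∑ i ∈ s, (f i).totalDegree := by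
  classical
  induction s using Finset.induction_on with
  | empty => simp
  | insert a s ha ih =>
    have hs : ∀ i ∈ s, f i ≠ 0 := fun i hi => h i (Finset.mem_insert_of_mem hi)
    rw [Finset.prod_insert ha, Finset.sum_insert ha, totalDegree_mul_of_isDomain
      (h a (Finset.mem_insert_self a s)) (Finset.prod_ne_zero_iff.2 hs), ih hs]

theorem totalDegree_pow_of_ne_zero {f : MvPolynomial σ ℝ} (h : f ≠ 0) (m : ℕ) :
    (f ^ m).totalDegree = m * f.totalDegree := by
  rw [← Finset.card_range m, ← Finset.prod_const, totalDegree_finsetProd_of_ne_zero fun _ _ => h]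
  simp

/-- The total degree of a determinant is bounded by the sum of column bounds. -/
theorem totalDegree_det_le {ι : Type} [Fintype ι] [DecidableEq ι]
    {A : Matrix ι ι (MvPolynomial σ ℝ)} {d : ι → ℕ} (h : ∀ i j, (A i j).totalDegree ≤ d j) :
    A.det.totalDegree ≤ ∑ j, d j := by
  rw [Matrix.det_apply]
  refine totalDegree_finsetSum_le fun τ _ => ?_
  have : (Equiv.Perm.sign τ • ∏ i, A (τ i) i).totalDegree ≤ (∏ i, A (τ i) i).totalDegree := by
    rcases Int.units_eq_one_or (Equiv.Perm.sign τ) with h | h <;> simp [h, totalDegree_neg]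
  refine this.trans ((totalDegree_finsetProd _ _).trans (Finset.sum_le_sum fun i _ => h _ _))

/-- The restriction of a polynomial to the line through `x` with direction `u`. -/
def lineRestrict (x u : σ → ℝ) : MvPolynomial σ ℝ →ₐ[ℝ] Polynomial ℝ :=
  aeval fun i => Polynomial.C (x i) + Polynomial.X * Polynomial.C (u i)

theorem eval_lineRestrict (x u : σ → ℝ) (t : ℝ) (q : MvPolynomial σ ℝ) :
    (lineRestrict x u q).eval t = eval (x + t • u) q := by
  induction q using MvPolynomial.induction_on with
  | C a => simp [lineRestrict]
  | add p q hp hq => simp [hp, hq]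
  | mul_X p i hp => rw [map_mul, Polynomial.eval_mul, hp]; simp [lineRestrict, mul_comm t]

variable [Fintype σ]

theorem contDiff_eval {m : WithTop ℕ∞} (p : MvPolynomial σ ℝ) :
    ContDiff ℝ m fun x : σ → ℝ => eval x p := by
  induction p using MvPolynomial.induction_on with
  | C a => simpa using contDiff_const
  | add p q hp hq => simpa using hp.add hq
  | mul_X p i hp => simpa using hp.mul (contDiff_apply ℝ ℝ i)

theorem eq_zero_of_eval_eq_zero_on_open {U : Set (σ → ℝ)} (hU : IsOpen U) (hne : U.Nonempty)
    {p : MvPolynomial σ ℝ} (h : ∀ x ∈ U, eval x p = 0) : p = 0 := by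
  obtain ⟨x, hx⟩ := hne
  obtain ⟨ε, hε, hball⟩ := Metric.isOpen_iff.1 hU x hx
  refine funext_set (fun i => Metric.ball (x i) ε) (fun i => ?_) fun y hy => ?_
  · rw [Real.ball_eq_Ioo]
    exact Set.Ioo_infinite (by linarith)
  · rw [map_zero]
    refine h y (hball ?_)
    rw [ball_pi _ hε]
    exact hy

/-- A polynomial vanishing on a relatively open piece of a hyperplane is divisible by the
equation of the hyperplane. -/
theorem dvd_of_eval_eq_zero_on_hyperplane {l q : MvPolynomial σ ℝ} {u : σ → ℝ}
    (hl : ∀ (x : σ → ℝ) (t : ℝ), eval (x + t • u) l = eval x l + t)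
    {U : Set (σ → ℝ)} (hU : IsOpen U) {x₀ : σ → ℝ} (hx₀ : x₀ ∈ U) (hlx₀ : eval x₀ l = 0)
    (h : ∀ x ∈ U, eval x l = 0 → eval x q = 0) : l ∣ q := by
  set q' : MvPolynomial σ ℝ := bind₁ (fun i => X i - C (u i) * l) q with hq'
  have hev : ∀ x, eval x q' = eval (x + (-eval x l) • u) q := by
    intro x
    rw [hq', ← coe_aeval_eq_eval, ← coe_aeval_eq_eval, RingHom.coe_coe, RingHom.coe_coe,
      aeval_bind₁]
    congr 2
    ext i
    simp [aeval_eq_eval]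
    ring
  have hcont : Continuous fun x : σ → ℝ => x + (-eval x l) • u := by
    have := (contDiff_eval (m := 0) l).continuous
    fun_prop
  have hzero : q' = 0 := by
    refine eq_zero_of_eval_eq_zero_on_open (hU.preimage hcont) ⟨x₀, by simpa [hlx₀]⟩
      fun x hx => ?_
    rw [hev]
    exact h _ hx (by rw [hl]; ring)
  have hmod : (Ideal.Quotient.mkₐ ℝ (Ideal.span {l})).comp
      (bind₁ (fun i => X i - C (u i) * l)) = Ideal.Quotient.mkₐ ℝ (Ideal.span {l}) := by
    ext i
    simp only [AlgHom.comp_apply, bind₁_X_right, Ideal.Quotient.mkₐ_eq_mk]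
    rw [Ideal.Quotient.eq, Ideal.mem_span_singleton]
    exact ⟨-C (u i), by ring⟩
  have := DFunLike.congr_fun hmod q
  rw [AlgHom.comp_apply, ← hq', hzero, map_zero] at this
  rw [← Ideal.mem_span_singleton, ← Ideal.Quotient.eq_zero_iff_mem]
  exact this.symm

theorem pow_dvd_of_lineRestrict {l q : MvPolynomial σ ℝ} {u : σ → ℝ}
    (hl : ∀ (x : σ → ℝ) (t : ℝ), eval (x + t • u) l = eval x l + t)
    {U : Set (σ → ℝ)} (hU : IsOpen U) {x₀ : σ → ℝ} (hx₀ : x₀ ∈ U) (hlx₀ : eval x₀ l = 0)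
    {m : ℕ} (h : ∀ x ∈ U, eval x l = 0 → Polynomial.X ^ m ∣ lineRestrict x u q) : l ^ m ∣ q := by
  suffices ∀ d ≤ m, l ^ d ∣ q from this m le_rfl
  intro d
  induction d with
  | zero => simp
  | succ d ih =>
    intro hd
    obtain ⟨q', rfl⟩ := ih (by omega)
    rw [pow_succ]
    refine mul_dvd_mul_left _ (dvd_of_eval_eq_zero_on_hyperplane hl hU hx₀ hlx₀ fun x hx hlx => ?_)
    have hX : lineRestrict x u l = Polynomial.X :=
      Polynomial.funext fun t => by rw [eval_lineRestrict, hl, hlx, zero_add, Polynomial.eval_X]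
    have h1 := h x hx hlx
    rw [map_mul, map_pow, hX] at h1
    have h2 : (Polynomial.X : Polynomial ℝ) ^ d * Polynomial.X ∣
        Polynomial.X ^ d * lineRestrict x u q' :=
      (pow_succ (Polynomial.X : Polynomial ℝ) d ▸ pow_dvd_pow _ hd).trans h1
    rw [mul_dvd_mul_iff_left (pow_ne_zero _ Polynomial.X_ne_zero), Polynomial.X_dvd_iff,
      Polynomial.coeff_zero_eq_eval_zero, eval_lineRestrict] at h2
    simpa using h2

theorem card_finsupp_sum_le (n m : ℕ) :
    Nat.card {s : Fin n →₀ ℕ | (s.sum fun _ a => a) ≤ m} = (m + n).choose n := by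
  have hset : {s : Fin n →₀ ℕ | (s.sum fun _ a => a) ≤ m} =
      ((Finset.range (m + 1)).biUnion fun d => (Finset.univ : Finset (Fin n)).finsuppAntidiag d :
        Finset (Fin n →₀ ℕ)) := by
    ext s
    simp [Finset.mem_finsuppAntidiag, Finsupp.sum_fintype]
  rw [hset, Nat.card_coe_set_eq, Set.ncard_coe_finset, Finset.card_biUnion]
  · simp only [Finset.card_finsuppAntidiag_nat_eq_choose, Finset.card_univ, Fintype.card_fin]
    clear hset
    induction m with
    | zero => simp
    | succ m ih =>
      have h1 : (m + n).choose n = (m + n).choose m := by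
        rw [add_comm m n, Nat.choose_symm_add]
      have h2 : (m + 1 + n).choose n = (m + 1 + n).choose (m + 1) := by
        rw [add_comm (m + 1) n, Nat.choose_symm_add]
      rw [Finset.sum_range_succ, ih, show n + (m + 1) - 1 = m + n by omega, h1, h2,
        show m + 1 + n = m + n + 1 by omega, Nat.choose_succ_succ]
  · intro a _ b _ hab
    rw [Function.onFun, Finset.disjoint_left]
    intro s hs hs'
    rw [Finset.mem_finsuppAntidiag] at hs hs'
    exact hab (hs.1.symm.trans hs'.1)

theorem finrank_restrictTotalDegree (n m : ℕ) :
    Module.finrank ℝ (restrictTotalDegree (Fin n) ℝ m) = (m + n).choose n := by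
  rw [← card_finsupp_sum_le]
  exact Module.finrank_eq_nat_card_basis (basisRestrictSupport ℝ _)

/-- The polynomials `g` with `deg g + d ≤ k`, including `0` for all `d` and `k`. -/
def restrictShiftedDegree (n k d : ℕ) : Submodule ℝ (MvPolynomial (Fin n) ℝ) :=
  if d ≤ k then restrictTotalDegree (Fin n) ℝ (k - d) else ⊥

theorem mem_restrictShiftedDegree {n k d : ℕ} {g : MvPolynomial (Fin n) ℝ} :
    g ∈ restrictShiftedDegree n k d ↔ (g ≠ 0 → g.totalDegree + d ≤ k) := by
  unfold restrictShiftedDegree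
  split_ifs with h
  · rw [mem_restrictTotalDegree]
    by_cases hg : g = 0
    · simp [hg]
    · simp only [ne_eq, hg, not_false_eq_true, true_imp_iff]
      omega
  · rw [Submodule.mem_bot]
    by_cases hg : g = 0
    · simp [hg]
    · simp only [ne_eq, hg, not_false_eq_true, true_imp_iff, false_iff]
      omega

instance (n k d : ℕ) : Module.Finite ℝ (restrictShiftedDegree n k d) := by
  rcases le_or_gt d k with h | h
  · rw [restrictShiftedDegree, if_pos h]; infer_instance
  · rw [restrictShiftedDegree, if_neg h.not_ge]; infer_instance

theorem finrank_restrictShiftedDegree {n : ℕ} (hn : 1 ≤ n) (k d : ℕ) :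
    Module.finrank ℝ (restrictShiftedDegree n k d) = (k + n - d).choose n := by
  rcases le_or_gt d k with h | h
  · rw [restrictShiftedDegree, if_pos h, finrank_restrictTotalDegree, Nat.sub_add_comm h]
  · rw [restrictShiftedDegree, if_neg h.not_ge, finrank_bot, Nat.choose_eq_zero_of_lt (by omega)]

end MvPolynomial

namespace Polynomial

open scoped Polynomial

section Antiderivative

variable {S : Type} [CommRing S] [Algebra ℝ S]

/-- The antiderivative of a polynomial with vanishing constant coefficient. -/
def antiderivative (P : S[X]) : S[X] :=
  P.sum fun k c => monomial (k + 1) (((k : ℝ) + 1)⁻¹ • c)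

theorem derivative_antiderivative (P : S[X]) : derivative (antiderivative P) = P := by
  conv_rhs => rw [← P.sum_monomial_eq]
  simp only [antiderivative, Polynomial.sum, derivative_sum, derivative_monomial]
  refine Finset.sum_congr rfl fun k _ => ?_
  congr 1
  have hk : (k : ℝ) + 1 ≠ 0 := by positivity
  rw [show ((k + 1 : ℕ) : S) = algebraMap ℝ S ((k : ℝ) + 1) by simp, mul_comm,
    ← Algebra.smul_def, smul_smul, mul_inv_cancel₀ hk, one_smul]

theorem eval_sub_eval_eq_of_derivative_eq [IsDomain S] {G H : S[X]}
    (h : derivative G = derivative H) (a b : S) :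
    G.eval b - G.eval a = H.eval b - H.eval a := by
  have : CharZero S := charZero_of_injective_algebraMap (algebraMap ℝ S).injective
  have h0 : derivative (G - H) = 0 := by rw [derivative_sub, h, sub_self]
  have h1 := eq_C_of_natDegree_eq_zero (derivative_eq_zero.1 h0)
  have h2 : (G - H).eval b = (G - H).eval a := by rw [h1, eval_C, eval_C]
  rw [eval_sub, eval_sub] at h2
  linear_combination h2

/-- If the integrand vanishes to order `s` at both `a` and `b`, then the integral from `a` to `b`
is divisible by `(b - a) ^ (2 * s + 1)`. -/
theorem pow_dvd_eval_antiderivative_sub [IsDomain S] {P : S[X]} {a b : S} {s : ℕ}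
    (hP : (X - C a) ^ s * (X - C b) ^ s ∣ P) :
    (b - a) ^ (2 * s + 1) ∣ (antiderivative P).eval b - (antiderivative P).eval a := by
  obtain ⟨H, rfl⟩ := hP
  set G := antiderivative ((X - C a) ^ s * (X - C b) ^ s * H)
  set L : S[X] := C a + C (b - a) * X with hL
  set R : S[X] := X ^ s * (X - 1) ^ s * H.comp L
  have h1 : derivative (G.comp L) = derivative (C ((b - a) ^ (2 * s + 1)) * antiderivative R) := by
    rw [derivative_comp, derivative_C_mul, derivative_antiderivative, derivative_antiderivative]
    simp only [mul_comp, pow_comp, sub_comp, X_comp, C_comp, R]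
    have e1 : L - C a = C (b - a) * X := by rw [hL]; ring
    have e2 : L - C b = C (b - a) * (X - 1) := by rw [hL, C_sub]; ring
    have e3 : derivative L = C (b - a) := by simp [hL]
    rw [e1, e2, e3, mul_pow, mul_pow, C_pow]
    ring
  have h2 := eval_sub_eval_eq_of_derivative_eq h1 0 1
  rw [eval_comp, eval_comp] at h2
  simp only [hL, eval_add, eval_mul, eval_C, eval_X, mul_one, mul_zero, add_zero,
    add_sub_cancel] at h2
  exact ⟨_, h2.trans (mul_sub _ _ _).symm⟩

end Antiderivative

/-- Polynomials over a multivariate polynomial ring whose total degree, counting the outer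
variable with weight one, is at most `D`. -/
def TotalDegreeLE {σ : Type} (P : (MvPolynomial σ ℝ)[X]) (D : ℕ) : Prop :=
  ∀ k, P.coeff k ≠ 0 → (P.coeff k).totalDegree + k ≤ D

section TotalDegreeLE

variable {σ : Type} {P Q : (MvPolynomial σ ℝ)[X]} {D E : ℕ}

theorem TotalDegreeLE.mul (hP : TotalDegreeLE P D) (hQ : TotalDegreeLE Q E) :
    TotalDegreeLE (P * Q) (D + E) := by
  intro k hk
  rw [coeff_mul] at hk ⊢
  have hterm : ∀ x ∈ Finset.HasAntidiagonal.antidiagonal k, P.coeff x.1 * Q.coeff x.2 ≠ 0 →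
      (P.coeff x.1 * Q.coeff x.2).totalDegree + k ≤ D + E := by
    intro x hx hne
    have h1 := hP x.1 (left_ne_zero_of_mul hne)
    have h2 := hQ x.2 (right_ne_zero_of_mul hne)
    have h3 := MvPolynomial.totalDegree_mul (P.coeff x.1) (Q.coeff x.2)
    have h4 := Finset.HasAntidiagonal.mem_antidiagonal.1 hx
    omega
  obtain ⟨x, hx, hne⟩ := Finset.exists_ne_zero_of_sum_ne_zero hk
  have hkD : k ≤ D + E := by have := hterm x hx hne; omega
  have : (∑ x ∈ Finset.HasAntidiagonal.antidiagonal k, P.coeff x.1 * Q.coeff x.2).totalDegree ≤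
      D + E - k := by
    refine MvPolynomial.totalDegree_finsetSum_le fun y hy => ?_
    by_cases hy0 : P.coeff y.1 * Q.coeff y.2 = 0
    · simp [hy0]
    · have := hterm y hy hy0
      omega
  omega

theorem totalDegreeLE_one : TotalDegreeLE (1 : (MvPolynomial σ ℝ)[X]) 0 := by
  intro k hk
  rw [coeff_one] at hk ⊢
  split_ifs at hk ⊢ with h
  · simp [h]
  · exact absurd rfl hk

theorem TotalDegreeLE.pow (hP : TotalDegreeLE P D) (m : ℕ) : TotalDegreeLE (P ^ m) (m * D) := by
  induction m with
  | zero => simpa using totalDegreeLE_one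
  | succ m ih => rw [pow_succ, Nat.succ_mul]; exact ih.mul hP

theorem TotalDegreeLE.prod {ι : Type} (s : Finset ι) {P : ι → (MvPolynomial σ ℝ)[X]} {D : ℕ}
    (hP : ∀ i, TotalDegreeLE (P i) D) : TotalDegreeLE (∏ i ∈ s, P i) (s.card * D) := by
  classical
  induction s using Finset.induction_on with
  | empty => simpa using totalDegreeLE_one
  | insert a s ha ih =>
    rw [Finset.prod_insert ha, Finset.card_insert_of_notMem ha, Nat.succ_mul, add_comm]
    exact (hP a).mul ih

theorem totalDegreeLE_X_sub_C {l : MvPolynomial σ ℝ} (hl : l.totalDegree ≤ 1) :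
    TotalDegreeLE (X - C l) 1 := by
  intro k hk
  match k with
  | 0 => simpa [MvPolynomial.totalDegree_neg] using hl
  | 1 => simp
  | k + 2 => simp [coeff_X] at hk

theorem totalDegreeLE_X : TotalDegreeLE (X : (MvPolynomial σ ℝ)[X]) 1 := by
  simpa using totalDegreeLE_X_sub_C (σ := σ) (l := 0) (by simp)

theorem TotalDegreeLE.totalDegree_eval_antiderivative (hP : TotalDegreeLE P D)
    {l : MvPolynomial σ ℝ} (hl : l.totalDegree ≤ 1) :
    ((antiderivative P).eval l).totalDegree ≤ D + 1 := by
  simp only [antiderivative, Polynomial.sum, eval_finsetSum, eval_monomial]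
  refine MvPolynomial.totalDegree_finsetSum_le fun k hk => ?_
  have h1 := hP k (mem_support_iff.1 hk)
  have h2 := MvPolynomial.totalDegree_smul_le ((k : ℝ) + 1)⁻¹ (P.coeff k)
  have h3 := (MvPolynomial.totalDegree_pow l (k + 1)).trans (Nat.mul_le_mul_left _ hl)
  have h4 := MvPolynomial.totalDegree_mul (((k : ℝ) + 1)⁻¹ • P.coeff k) (l ^ (k + 1))
  omega

end TotalDegreeLE

/-- A real polynomial of degree less than `n` is zero if its integrals against a weight without
zeros in the open intervals between `n + 1` increasing points all vanish. -/
theorem eq_zero_of_integrals_eq_zero {n : ℕ} {y : Fin (n + 1) → ℝ} (hy : StrictMono y)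
    {p w G : ℝ[X]} (hp : p.degree < n)
    (hw : ∀ t, w.eval t = 0 → ∃ i, t = y i) (hG : derivative G = p * w)
    (h0 : ∀ i, G.eval (y i) = G.eval (y 0)) : p = 0 := by
  have hroot : ∀ i : Fin n, ∃ t ∈ Set.Ioo (y i.castSucc) (y i.succ), p.eval t = 0 := by
    intro i
    obtain ⟨t, ht, hd⟩ := exists_deriv_eq_zero (f := fun t => G.eval t)
      (hy i.castSucc_lt_succ) G.continuous.continuousOn ((h0 _).trans (h0 _).symm)
    refine ⟨t, ht, ?_⟩
    rw [Polynomial.deriv, hG, eval_mul, mul_eq_zero] at hd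
    refine hd.resolve_right fun hwt => ?_
    obtain ⟨j, rfl⟩ := hw t hwt
    have h1 := hy.lt_iff_lt.1 ht.1
    have h2 := hy.lt_iff_lt.1 ht.2
    rw [Fin.lt_def] at h1 h2
    simp at h1 h2
    omega
  choose t ht hpt using hroot
  have hinj : Function.Injective t := by
    refine StrictMono.injective fun i j hij => ?_
    have : y i.succ ≤ y j.castSucc := hy.monotone (Fin.le_def.2 (by simpa using hij))
    exact ((ht i).2.trans_le this).trans (ht j).1
  exact eq_zero_of_degree_lt_of_eval_index_eq_zero Finset.univ hinj.injOn
    (by simpa using hp) fun i _ => hpt i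

end Polynomial

/-- Linear forms `L 0, …, L n` on `ℝ^n` that behave like barycentric coordinates up to positive
factors: the positive vectors are realized up to scaling, and each difference `L j - L i` has a
direction along which it grows with unit speed. -/
structure IsBarycentricSystem {n : ℕ} (L : Fin (n + 1) → MvPolynomial (Fin n) ℝ) : Prop where
  totalDegree_le : ∀ i, (L i).totalDegree ≤ 1
  exists_eval_eq : ∀ y : Fin (n + 1) → ℝ, (∀ i, 0 < y i) →
    ∃ (x : Fin n → ℝ) (c : ℝ), 0 < c ∧ ∀ i, eval x (L i) = c * y i
  exists_direction : ∀ i j, i ≠ j → ∃ u : Fin n → ℝ, ∀ (x : Fin n → ℝ) (t : ℝ),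
    eval (x + t • u) (L j - L i) = eval x (L j - L i) + t

namespace IsBarycentricSystem

variable {n : ℕ} {L : Fin (n + 1) → MvPolynomial (Fin n) ℝ}

theorem totalDegree_sub (hL : IsBarycentricSystem L) {i j : Fin (n + 1)} (hij : i ≠ j) :
    (L j - L i).totalDegree = 1 := by
  obtain ⟨u, hu⟩ := hL.exists_direction i j hij
  exact totalDegree_eq_one_of_eval_add_smul ((MvPolynomial.totalDegree_sub _ _).trans
    (max_le (hL.totalDegree_le j) (hL.totalDegree_le i))) hu

theorem irreducible_sub (hL : IsBarycentricSystem L) {i j : Fin (n + 1)} (hij : i ≠ j) :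
    Irreducible (L j - L i) :=
  irreducible_of_totalDegree_eq_one' (hL.totalDegree_sub hij)

theorem not_sub_dvd_sub (hL : IsBarycentricSystem L) {i j i' j' : Fin (n + 1)}
    (hij : i < j) (hij' : i' < j') (hne : ¬ (i = i' ∧ j = j')) :
    ¬ (L j - L i ∣ L j' - L i') := by
  rintro ⟨q, hq⟩
  obtain ⟨x, c, hc, hx⟩ := hL.exists_eval_eq
    (fun l => if l = j then (i : ℝ) + 1 else (l : ℝ) + 1)
    (fun l => by split_ifs <;> positivity)
  have h := congrArg (eval x) hq
  rw [map_mul, map_sub, map_sub, hx, hx, hx, hx, if_pos rfl, if_neg hij.ne, sub_self, zero_mul,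
    sub_eq_zero, mul_right_inj' hc.ne'] at h
  rw [Fin.lt_def] at hij hij'
  simp only [Fin.ext_iff] at h hne
  split_ifs at h with h1 h2 h2
  all_goals
    simp only [add_left_inj, Nat.cast_inj] at h
    omega

/-- Pairwise divisibility by powers of the distinct forms `L j - L i` implies divisibility by
their product. -/
theorem prod_dvd (hL : IsBarycentricSystem L) (m : ℕ) {q : MvPolynomial (Fin n) ℝ}
    (h : ∀ i j, i < j → (L j - L i) ^ m ∣ q) :
    ∏ x ∈ (Finset.univ : Finset (Fin (n + 1))).sigma (fun j => Finset.Iio j),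
      (L x.1 - L x.2) ^ m ∣ q := by
  refine Finset.prod_dvd_of_isRelPrime (fun x hx y hy hxy => IsRelPrime.pow ?_) fun x hx => ?_
  · simp only [Finset.coe_sigma, Set.mem_sigma_iff, Finset.mem_coe, Finset.mem_Iio] at hx hy
    refine ((hL.irreducible_sub hx.2.ne).isRelPrime_iff_not_dvd).2
      (hL.not_sub_dvd_sub hx.2 hy.2 fun h => hxy ?_)
    exact Sigma.ext h.2 (heq_of_eq h.1)
  · exact h _ _ (Finset.mem_Iio.1 (Finset.mem_sigma.1 hx).2)

theorem totalDegree_prod (hL : IsBarycentricSystem L) (m : ℕ) :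
    (∏ x ∈ (Finset.univ : Finset (Fin (n + 1))).sigma (fun j => Finset.Iio j),
      (L x.1 - L x.2) ^ m).totalDegree = ∑ j : Fin (n + 1), (j : ℕ) * m := by
  have hne : ∀ x ∈ (Finset.univ : Finset (Fin (n + 1))).sigma (fun j => Finset.Iio j),
      x.2 ≠ x.1 := fun x hx => (Finset.mem_Iio.1 (Finset.mem_sigma.1 hx).2).ne
  rw [totalDegree_finsetProd_of_ne_zero fun x hx =>
      pow_ne_zero m (hL.irreducible_sub (hne x hx)).ne_zero,
    Finset.sum_congr rfl fun x hx => (totalDegree_pow_of_ne_zero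
      (hL.irreducible_sub (hne x hx)).ne_zero m).trans
        (by rw [hL.totalDegree_sub (hne x hx), mul_one]), Finset.sum_sigma]
  simp

/-- If the columns of a matrix satisfy the congruences modulo `(L j - L i) ^ m`, then the product of
all these powers divides its determinant. -/
theorem prod_dvd_det (hL : IsBarycentricSystem L) (m : ℕ)
    {N : Fin (n + 1) → Fin n → MvPolynomial (Fin n) ℝ} (h0 : ∀ a, N 0 a = 0)
    (hN : ∀ i j a, (L j - L i) ^ m ∣ N j a - N i a) :
    ∏ x ∈ (Finset.univ : Finset (Fin (n + 1))).sigma (fun j => Finset.Iio j),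
      (L x.1 - L x.2) ^ m ∣ (Matrix.of fun i : Fin n => N i.succ).det := by
  refine hL.prod_dvd m fun i j hij => ?_
  rw [← Ideal.mem_span_singleton, ← Ideal.Quotient.eq_zero_iff_mem, RingHom.map_det]
  have heq : ∀ a, Ideal.Quotient.mk (Ideal.span {(L j - L i) ^ m}) (N j a) =
      Ideal.Quotient.mk (Ideal.span {(L j - L i) ^ m}) (N i a) := fun a => by
    rw [Ideal.Quotient.eq, Ideal.mem_span_singleton]
    exact hN i j a
  obtain ⟨j, rfl⟩ := Fin.exists_succ_eq.2 (Fin.ne_zero_of_lt hij)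
  rcases Fin.eq_zero_or_eq_succ i with rfl | ⟨i, rfl⟩
  · refine Matrix.det_eq_zero_of_row_eq_zero j fun a => ?_
    simpa [h0] using heq a
  · refine Matrix.det_zero_of_row_eq (i := j) (j := i) (fun h => hij.ne (h ▸ rfl)) ?_
    ext1 a
    exact heq a

/-- **Saito's criterion**: vectors whose degrees add up to the degree of the product of the forms
`(L j - L i) ^ m`, and which satisfy the congruences modulo these forms, generate all vectors
satisfying the congruences as soon as their determinant is nonzero. -/
theorem exists_eq_sum_mul (hL : IsBarycentricSystem L) (m : ℕ)
    {N : Fin (n + 1) → Fin n → MvPolynomial (Fin n) ℝ} (hN0 : ∀ a, N 0 a = 0)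
    (hN : ∀ i j a, (L j - L i) ^ m ∣ N j a - N i a)
    (hdet : (Matrix.of fun i : Fin n => N i.succ).det ≠ 0)
    {d : Fin n → ℕ} (hd : ∀ i a, (N i a).totalDegree ≤ d a)
    (hsum : ∑ a, d a = ∑ j : Fin (n + 1), (j : ℕ) * m)
    {H : Fin (n + 1) → MvPolynomial (Fin n) ℝ} (hH0 : H 0 = 0)
    (hH : ∀ i j, (L j - L i) ^ m ∣ H j - H i) {k : ℕ} (hk : ∀ i, (H i).totalDegree ≤ k) :
    ∃ g : Fin n → MvPolynomial (Fin n) ℝ, (∀ a, g a ∈ restrictShiftedDegree n k (d a)) ∧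
      ∀ i, H i = ∑ a, g a * N i a := by
  set M : Matrix (Fin n) (Fin n) (MvPolynomial (Fin n) ℝ) := Matrix.of fun i => N i.succ with hM
  set Q := ∏ x ∈ (Finset.univ : Finset (Fin (n + 1))).sigma (fun j => Finset.Iio j),
      (L x.1 - L x.2) ^ m with hQ
  have hQdeg : Q.totalDegree = ∑ a, d a := by rw [hsum, hQ, hL.totalDegree_prod]
  obtain ⟨c, hc⟩ : ∃ c : ℝ, M.det = Q * C c := by
    obtain ⟨h, hh⟩ := hL.prod_dvd_det m hN0 hN
    rw [← hQ, ← hM] at hh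
    have h1 : M.det.totalDegree ≤ ∑ a, d a := totalDegree_det_le fun i a => hd i.succ a
    rw [hh] at hdet
    rw [hh, totalDegree_mul_of_isDomain (left_ne_zero_of_mul hdet) (right_ne_zero_of_mul hdet),
      hQdeg] at h1
    refine ⟨h.coeff 0, ?_⟩
    rw [hh, ← totalDegree_eq_zero_iff_eq_C.1 (by omega)]
  have hQ0 : Q ≠ 0 := left_ne_zero_of_mul (hc ▸ hdet)
  have hc0 : c ≠ 0 := by
    rintro rfl
    simp [hc] at hdet
  set b : Fin n → MvPolynomial (Fin n) ℝ := fun i => H i.succ with hb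
  have hcr : ∀ a, ∃ g, M.cramer b a = Q * g := by
    intro a
    have := hL.prod_dvd_det m (N := fun i => Function.update (N i) a (H i))
      (fun a' => by
        by_cases h : a' = a
        · subst h; simp [hH0]
        · simp [h, hN0])
      (fun i j a' => by
        by_cases h : a' = a
        · subst h; simpa using hH i j
        · simpa [h] using hN i j a')
    obtain ⟨g, hg⟩ := this
    refine ⟨g, ?_⟩
    rw [Matrix.cramer_apply, hQ, ← hg]
    rfl
  choose g hg using hcr
  have hsol : ∀ i : Fin n, ∑ a, g a * N i.succ a = C c * H i.succ := by
    intro i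
    have h1 := congrFun (Matrix.mulVec_cramer M b) i
    simp only [Matrix.mulVec, dotProduct, hg, Pi.smul_apply, smul_eq_mul, hc] at h1
    refine mul_left_cancel₀ hQ0 ?_
    rw [Finset.mul_sum, ← mul_assoc]
    refine Eq.trans (Finset.sum_congr rfl fun a _ => ?_) h1
    simp only [hM, Matrix.of_apply]
    ring
  refine ⟨fun a => c⁻¹ • g a, fun a => Submodule.smul_mem _ _ ?_, fun i => ?_⟩
  · rw [mem_restrictShiftedDegree]
    intro hga
    have h1 : (M.cramer b a).totalDegree ≤ ∑ a', Function.update d a k a' := by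
      rw [Matrix.cramer_apply]
      refine totalDegree_det_le fun i a' => ?_
      by_cases h : a' = a
      · subst h; simpa [hb] using hk _
      · simpa [h, hM] using hd _ _
    rw [hg, totalDegree_mul_of_isDomain hQ0 hga, hQdeg,
      Finset.sum_update_of_mem (Finset.mem_univ a)] at h1
    rw [← Finset.add_sum_erase _ d (Finset.mem_univ a), ← Finset.sdiff_singleton_eq_erase] at h1
    omega
  · rcases Fin.eq_zero_or_eq_succ i with rfl | ⟨i, rfl⟩
    · simp [hN0, hH0]
    · simp only [smul_mul_assoc, ← Finset.smul_sum, hsol]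
      rw [← smul_eq_C_mul, smul_smul, inv_mul_cancel₀ hc0, one_smul]

end IsBarycentricSystem

section IntegralBasis

variable {n : ℕ}

/-- The integrand `t ^ a * ∏ l, (t - L l) ^ s`. -/
def integrand (L : Fin (n + 1) → MvPolynomial (Fin n) ℝ) (s a : ℕ) :
    Polynomial (MvPolynomial (Fin n) ℝ) :=
  Polynomial.X ^ a * ∏ i, (Polynomial.X - Polynomial.C (L i)) ^ s

/-- The integral from `L 0` to `L i` of `t ^ a * ∏ l, (t - L l) ^ s`. For varying `a < n` these are
the components of a basis of the vectors satisfying the congruences modulo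
`(L j - L i) ^ (2 * s + 1)`. -/
def integralBasis (L : Fin (n + 1) → MvPolynomial (Fin n) ℝ) (s : ℕ) (i : Fin (n + 1))
    (a : Fin n) : MvPolynomial (Fin n) ℝ :=
  (integrand L s a).antiderivative.eval (L i) - (integrand L s a).antiderivative.eval (L 0)

variable {L : Fin (n + 1) → MvPolynomial (Fin n) ℝ}

theorem integralBasis_zero (s : ℕ) (a : Fin n) : integralBasis L s 0 a = 0 := sub_self _

theorem pow_dvd_integralBasis_sub (s : ℕ) (i j : Fin (n + 1)) (a : Fin n) :
    (L j - L i) ^ (2 * s + 1) ∣ integralBasis L s j a - integralBasis L s i a := by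
  rw [integralBasis, integralBasis, sub_sub_sub_cancel_right]
  by_cases hij : i = j
  · simp [hij]
  · refine Polynomial.pow_dvd_eval_antiderivative_sub (Dvd.dvd.mul_left ?_ _)
    rw [← Finset.prod_pair (f := fun i => (Polynomial.X - Polynomial.C (L i)) ^ s) hij]
    exact Finset.prod_dvd_prod_of_subset _ _ _ (Finset.subset_univ _)

theorem totalDegree_integralBasis_le (hL : ∀ i, (L i).totalDegree ≤ 1) (s : ℕ)
    (i : Fin (n + 1)) (a : Fin n) :
    (integralBasis L s i a).totalDegree ≤ s * (n + 1) + (a + 1) := by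
  have h : Polynomial.TotalDegreeLE (integrand L s a) (a * 1 + (n + 1) * (s * 1)) := by
    have := (Polynomial.totalDegreeLE_X.pow (σ := Fin n) a).mul (Polynomial.TotalDegreeLE.prod
      Finset.univ fun i => (Polynomial.totalDegreeLE_X_sub_C (hL i)).pow s)
    simpa [integrand] using this
  have h1 := h.totalDegree_eval_antiderivative (hL i)
  have h2 := h.totalDegree_eval_antiderivative (hL 0)
  refine (MvPolynomial.totalDegree_sub _ _).trans (max_le ?_ ?_)
  · exact h1.trans (by linarith)
  · exact h2.trans (by linarith)

theorem det_integralBasis_ne_zero (hL : IsBarycentricSystem L) (s : ℕ) :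
    (Matrix.of fun i : Fin n => integralBasis L s i.succ).det ≠ 0 := by
  intro hdet
  obtain ⟨x, c, hc, hx⟩ := hL.exists_eval_eq (fun l => (l : ℝ) + 1) (fun l => by positivity)
  have h1 := congrArg (eval x) hdet
  rw [RingHom.map_det, map_zero] at h1
  obtain ⟨v, hv, hv0⟩ := Matrix.exists_mulVec_eq_zero_iff.2 h1
  refine hv ?_
  set y : Fin (n + 1) → ℝ := fun l => eval x (L l) with hy
  have hmono : StrictMono y := fun i j hij => by
    rw [Fin.lt_def] at hij
    simp only [hy, hx]
    gcongr
  set p : Polynomial ℝ := ∑ a : Fin n, Polynomial.C (v a) * Polynomial.X ^ (a : ℕ) with hp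
  set w : Polynomial ℝ := ∏ i, (Polynomial.X - Polynomial.C (y i)) ^ s with hw
  set G : Polynomial ℝ := ∑ a : Fin n, Polynomial.C (v a) *
    (integrand L s a).antiderivative.map (eval x) with hG
  have hp0 : p = 0 := by
    refine Polynomial.eq_zero_of_integrals_eq_zero hmono (w := w) (G := G)
      (Polynomial.degree_sum_fin_lt _) ?_ ?_ ?_
    · intro t ht
      rw [hw, Polynomial.eval_prod, Finset.prod_eq_zero_iff] at ht
      obtain ⟨i, -, hi⟩ := ht
      refine ⟨i, ?_⟩
      rw [Polynomial.eval_pow] at hi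
      simpa [sub_eq_zero] using eq_zero_of_pow_eq_zero hi
    · rw [hG, Polynomial.derivative_sum, hp, Finset.sum_mul]
      refine Finset.sum_congr rfl fun a _ => ?_
      rw [Polynomial.derivative_C_mul, Polynomial.derivative_map,
        Polynomial.derivative_antiderivative, integrand, Polynomial.map_mul, Polynomial.map_pow,
        Polynomial.map_X, Polynomial.map_prod, mul_assoc, hw]
      simp [hy]
    · intro i
      rcases Fin.eq_zero_or_eq_succ i with rfl | ⟨i, rfl⟩
      · rfl
      · have h2 := congrFun hv0 i
        simp only [Matrix.mulVec, dotProduct, RingHom.mapMatrix_apply, Matrix.map_apply,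
          Matrix.of_apply, integralBasis, Pi.zero_apply] at h2
        rw [← sub_eq_zero, ← h2, hG, Polynomial.eval_finsetSum, Polynomial.eval_finsetSum,
          ← Finset.sum_sub_distrib]
        refine Finset.sum_congr rfl fun a _ => ?_
        simp only [Polynomial.eval_mul, Polynomial.eval_C, map_sub, hy,
          Polynomial.eval₂_at_apply, Polynomial.eval_map]
        ring
  ext a
  have := congrArg (Polynomial.coeff · (a : ℕ)) hp0
  simpa [hp, Polynomial.finsetSum_coeff, Polynomial.coeff_X_pow, Fin.val_inj] using this

theorem sum_integralBasis_degree (s : ℕ) :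
    ∑ a : Fin n, (s * (n + 1) + ((a : ℕ) + 1)) = ∑ j : Fin (n + 1), (j : ℕ) * (2 * s + 1) := by
  rw [← Finset.sum_mul, Fin.sum_univ_succ]
  simp only [Fin.val_zero, zero_add, Fin.val_succ, Finset.sum_add_distrib, Finset.sum_const,
    Finset.card_univ, Fintype.card_fin, smul_eq_mul]
  have h := Finset.sum_range_id_mul_two n
  rw [← Fin.sum_univ_eq_sum_range (fun i => i)] at h
  rcases n with _ | n
  · simp
  · simp only [Nat.add_sub_cancel] at h
    linear_combination s * h.symm

end IntegralBasis

section Smoothness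

variable {n : ℕ} {L : Fin (n + 1) → MvPolynomial (Fin n) ℝ}

/-- If a function is `C^r` where all forms are positive and is there given by the polynomial `p i`
wherever `L i` is minimal, then the pieces satisfy the congruences modulo
`(L j - L i) ^ (r + 1)`. -/
theorem IsBarycentricSystem.pow_dvd_of_contDiffAt (hL : IsBarycentricSystem L) {r : ℕ}
    {F : (Fin n → ℝ) → ℝ} (hF : ∀ x, (∀ l, 0 < eval x (L l)) → ContDiffAt ℝ r F x)
    {p : Fin (n + 1) → MvPolynomial (Fin n) ℝ}
    (hp : ∀ i x, (∀ l, 0 < eval x (L l)) → (∀ l, eval x (L i) ≤ eval x (L l)) →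
      F x = eval x (p i)) (i j : Fin (n + 1)) : (L j - L i) ^ (r + 1) ∣ p j - p i := by
  by_cases hij : i = j
  · simp [hij]
  obtain ⟨u, hu⟩ := hL.exists_direction i j hij
  have hcont : ∀ l, Continuous fun x => eval x (L l) := fun l =>
    (contDiff_eval (m := 0) (L l)).continuous
  set U : Set (Fin n → ℝ) := (⋂ l, {x | 0 < eval x (L l)}) ∩
    ⋂ l, {x | l ≠ i → l ≠ j → eval x (L i) < eval x (L l) ∧ eval x (L j) < eval x (L l)} with hUdef
  have hU : IsOpen U := by
    refine (isOpen_iInter_of_finite fun l => isOpen_lt continuous_const (hcont l)).inter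
      (isOpen_iInter_of_finite fun l => ?_)
    by_cases h : l ≠ i ∧ l ≠ j
    · simp only [h.1, h.2, ne_eq, not_false_eq_true, true_imp_iff]
      exact (isOpen_lt (hcont i) (hcont l)).inter (isOpen_lt (hcont j) (hcont l))
    · convert isOpen_univ
      ext x
      simp only [Set.mem_univ, iff_true]
      exact fun h1 h2 => absurd ⟨h1, h2⟩ h
  obtain ⟨x₀, c, hc, hx₀⟩ := hL.exists_eval_eq (fun l => if l = i ∨ l = j then 1 else 2)
    (fun l => by split_ifs <;> norm_num)
  have hx₀U : x₀ ∈ U := by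
    simp only [hUdef, Set.mem_inter_iff, Set.mem_iInter, Set.mem_ofPred_eq, hx₀]
    refine ⟨fun l => mul_pos hc (by split_ifs <;> norm_num), fun l h1 h2 => ?_⟩
    simp only [h1, h2, true_or, or_true, or_self, if_true, if_false]
    constructor <;> linarith
  refine pow_dvd_of_lineRestrict hu hU hx₀U (by simp [hx₀]) fun x hx hlx => ?_
  rw [← dvd_neg, ← map_neg, neg_sub, map_sub]
  have hline : Continuous fun t : ℝ => x + t • u := by fun_prop
  have hnear : ∀ᶠ t in nhds (0 : ℝ), x + t • u ∈ U :=
    hline.continuousAt.eventually_mem (hU.mem_nhds (by simpa using hx))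
  have hval : ∀ t : ℝ, eval (x + t • u) (L j) - eval (x + t • u) (L i) = t := fun t => by
    rw [← map_sub, hu, hlx, zero_add]
  have hmin : ∀ i' t, x + t • u ∈ U → (i' = i ∧ 0 ≤ t ∨ i' = j ∧ t ≤ 0) →
      F (x + t • u) = (lineRestrict x u (p i')).eval t := by
    intro i' t ht h
    simp only [hUdef, Set.mem_inter_iff, Set.mem_iInter, Set.mem_ofPred_eq] at ht
    rw [eval_lineRestrict]
    refine hp i' _ ht.1 fun l => ?_
    have h1 := hval t
    by_cases hli : l = i
    · rcases h with ⟨rfl, h⟩ | ⟨rfl, h⟩ <;> subst hli <;> linarith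
    by_cases hlj : l = j
    · rcases h with ⟨rfl, h⟩ | ⟨rfl, h⟩ <;> subst hlj <;> linarith
    obtain ⟨h2, h3⟩ := ht.2 l hli hlj
    rcases h with ⟨rfl, h⟩ | ⟨rfl, h⟩
    exacts [h2.le, h3.le]
  refine Polynomial.X_pow_dvd_sub_of_contDiffAt (g := fun t => F (x + t • u)) ?_ ?_ ?_
  · refine ContDiffAt.comp (0 : ℝ) ?_ (by fun_prop)
    simp only [zero_smul, add_zero]
    exact hF x fun l => Set.mem_iInter.1 hx.1 l
  · filter_upwards [nhdsWithin_le_nhds hnear, self_mem_nhdsWithin] with t ht ht0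
    exact hmin i t ht (Or.inl ⟨rfl, le_of_lt ht0⟩)
  · filter_upwards [nhdsWithin_le_nhds hnear, self_mem_nhdsWithin] with t ht ht0
    exact hmin j t ht (Or.inr ⟨rfl, le_of_lt ht0⟩)

/-- Polynomials satisfying the congruences modulo `(L j - L i) ^ (r + 1)` glue to a function that
is given by the polynomial `p i` wherever `L i` is minimal; this function is `C^r`. -/
theorem contDiff_eval_of_pow_dvd {r : ℕ} {p : Fin (n + 1) → MvPolynomial (Fin n) ℝ}
    (hp : ∀ i j, (L j - L i) ^ (r + 1) ∣ p j - p i) {c : (Fin n → ℝ) → Fin (n + 1)}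
    (hc : ∀ x l, eval x (L (c x)) ≤ eval x (L l)) :
    (∀ i x, (∀ l, eval x (L i) ≤ eval x (L l)) → eval x (p (c x)) = eval x (p i)) ∧
      ContDiff ℝ r fun x => eval x (p (c x)) := by
  have heq : ∀ i x, (∀ l, eval x (L i) ≤ eval x (L l)) → eval x (p (c x)) = eval x (p i) := by
    intro i x hx
    obtain ⟨q, hq⟩ := hp i (c x)
    have h0 : eval x (L (c x)) = eval x (L i) := le_antisymm (hc x i) (hx (c x))
    rw [← sub_eq_zero, ← map_sub, hq]
    simp [h0]
  refine ⟨heq, contDiff_of_piecewise (A := fun i => ⋂ l, {x | eval x (L i) ≤ eval x (L l)})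
    (l := fun i j x => eval x (L i - L j)) (p := fun i x => eval x (p i))
    (fun i => isClosed_iInter fun l => isClosed_le (contDiff_eval (m := 0) _).continuous
      (contDiff_eval (m := 0) _).continuous)
    (fun x => ⟨c x, Set.mem_iInter.2 (hc x)⟩) (fun i j => contDiff_eval _) ?_ r
    (fun i => contDiff_eval _) (fun i x hx => heq i x (Set.mem_iInter.1 hx)) fun i j => ?_⟩
  · intro i j x hi hj
    rw [map_sub, sub_eq_zero]
    exact le_antisymm (Set.mem_iInter.1 hi j) (Set.mem_iInter.1 hj i)
  · obtain ⟨q, hq⟩ := hp j i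
    exact ⟨fun x => eval x q, contDiff_eval _, fun x => by rw [← map_sub, hq]; simp⟩

/-- A polynomial vanishing where all forms are positive and `L i` is minimal is zero. -/
theorem IsBarycentricSystem.eq_zero_of_eval_eq_zero (hL : IsBarycentricSystem L) (i : Fin (n + 1))
    {p : MvPolynomial (Fin n) ℝ} (hp : ∀ x, (∀ l, 0 < eval x (L l)) →
      (∀ l, eval x (L i) ≤ eval x (L l)) → eval x p = 0) : p = 0 := by
  have hcont : ∀ l, Continuous fun x => eval x (L l) := fun l =>
    (contDiff_eval (m := 0) (L l)).continuous
  obtain ⟨x₀, c, hc, hx₀⟩ := hL.exists_eval_eq (fun l => if l = i then 1 else 2)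
    (fun l => by split_ifs <;> norm_num)
  refine eq_zero_of_eval_eq_zero_on_open (U := (⋂ l, {x | 0 < eval x (L l)}) ∩
    ⋂ l, {x | l ≠ i → eval x (L i) < eval x (L l)}) ?_ ⟨x₀, ?_⟩ fun x hx => ?_
  · refine (isOpen_iInter_of_finite fun l => isOpen_lt continuous_const (hcont l)).inter
      (isOpen_iInter_of_finite fun l => ?_)
    by_cases h : l = i
    · simp [h]
    · simpa [h] using isOpen_lt (hcont i) (hcont l)
  · simp only [Set.mem_inter_iff, Set.mem_iInter, Set.mem_ofPred_eq, hx₀]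
    refine ⟨fun l => mul_pos hc (by split_ifs <;> norm_num), fun l h => ?_⟩
    simp only [h, if_true, if_false]
    linarith
  · simp only [Set.mem_inter_iff, Set.mem_iInter, Set.mem_ofPred_eq] at hx
    refine hp x hx.1 fun l => ?_
    by_cases h : l = i
    · rw [h]
    · exact (hx.2 l h).le

end Smoothness

section SplitForms

variable {n : ℕ}

/-- The polynomial of degree at most one representing an affine function. -/
def affinePolynomial (f : (Fin n → ℝ) →ᵃ[ℝ] ℝ) : MvPolynomial (Fin n) ℝ :=
  C (f 0) + ∑ i, C (f.linear (Pi.single i 1)) * X i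

theorem eval_affinePolynomial (f : (Fin n → ℝ) →ᵃ[ℝ] ℝ) (x : Fin n → ℝ) :
    eval x (affinePolynomial f) = f x := by
  have h : f.linear x = ∑ i, f.linear (Pi.single i 1) * x i := by
    rw [LinearMap.pi_apply_eq_sum_univ f.linear x]
    refine Finset.sum_congr rfl fun i _ => ?_
    rw [smul_eq_mul, mul_comm]
    congr 2
    ext j
    simp [Pi.single_apply, eq_comm]
  have h2 : f x = f.linear x + f 0 := congrFun (AffineMap.decomp f) x
  simp only [affinePolynomial, map_add, eval_C, map_sum, map_mul, eval_X]
  rw [h2, h, add_comm]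

theorem totalDegree_affinePolynomial_le (f : (Fin n → ℝ) →ᵃ[ℝ] ℝ) :
    (affinePolynomial f).totalDegree ≤ 1 := by
  refine (totalDegree_add _ _).trans (max_le (by simp) (totalDegree_finsetSum_le fun i _ => ?_))
  refine (totalDegree_mul _ _).trans ?_
  simp

/-- The barycentric coordinates of a simplex divided by those of the point `v`. -/
def splitForm (b : AffineBasis (Fin (n + 1)) ℝ (Fin n → ℝ)) (v : Fin n → ℝ) (l : Fin (n + 1)) :
    MvPolynomial (Fin n) ℝ :=
  affinePolynomial ((b.coord l v)⁻¹ • b.coord l)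

variable {b : AffineBasis (Fin (n + 1)) ℝ (Fin n → ℝ)} {v : Fin n → ℝ}

theorem eval_splitForm (l : Fin (n + 1)) (x : Fin n → ℝ) :
    eval x (splitForm b v l) = (b.coord l v)⁻¹ * b.coord l x := by
  rw [splitForm, eval_affinePolynomial]
  simp

theorem isBarycentricSystem_splitForm (hv : ∀ l, 0 < b.coord l v) :
    IsBarycentricSystem (splitForm b v) where
  totalDegree_le i := totalDegree_affinePolynomial_le _
  exists_eval_eq y hy := by
    have hpos : 0 < ∑ l, b.coord l v * y l :=
      Finset.sum_pos (fun l _ => mul_pos (hv l) (hy l)) Finset.univ_nonempty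
    refine ⟨Finset.univ.affineCombination ℝ b fun l =>
      (∑ l, b.coord l v * y l)⁻¹ * (b.coord l v * y l), (∑ l, b.coord l v * y l)⁻¹,
      inv_pos.2 hpos, fun i => ?_⟩
    rw [eval_splitForm, b.coord_apply_combination_of_mem (Finset.mem_univ i)]
    · have := (hv i).ne'
      field_simp
    · rw [← Finset.mul_sum, inv_mul_cancel₀ hpos.ne']
  exists_direction i j hij := by
    have hs : 0 < (b.coord j v)⁻¹ + (b.coord i v)⁻¹ :=
      add_pos (inv_pos.2 (hv j)) (inv_pos.2 (hv i))
    refine ⟨((b.coord j v)⁻¹ + (b.coord i v)⁻¹)⁻¹ • (b j - b i), fun x t => ?_⟩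
    have h : ∀ l, b.coord l (x + t • ((b.coord j v)⁻¹ + (b.coord i v)⁻¹)⁻¹ • (b j - b i)) =
        b.coord l x + t * (((b.coord j v)⁻¹ + (b.coord i v)⁻¹)⁻¹ *
          (b.coord l (b j) - b.coord l (b i))) := by
      intro l
      have h1 : (b.coord l).linear (b j - b i) = b.coord l (b j) - b.coord l (b i) :=
        (b.coord l).linearMap_vsub _ _
      have h2 := (b.coord l).map_vadd x
        (t • ((b.coord j v)⁻¹ + (b.coord i v)⁻¹)⁻¹ • (b j - b i))
      rw [map_smul, map_smul, h1, vadd_eq_add, vadd_eq_add, add_comm _ x] at h2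
      rw [h2, add_comm _ (b.coord l x), smul_eq_mul, smul_eq_mul]
    rw [map_sub, map_sub, eval_splitForm, eval_splitForm, eval_splitForm, eval_splitForm, h, h,
      b.coord_apply_eq, b.coord_apply_eq, b.coord_apply_ne hij, b.coord_apply_ne hij.symm]
    linear_combination t * mul_inv_cancel₀ hs.ne'

theorem splitForm_le_of_mem_alfeldCell (hv : ∀ l, 0 < b.coord l v) {i : Fin (n + 1)}
    {x : Fin n → ℝ} (hx : x ∈ alfeldCell b v i) (l : Fin (n + 1)) :
    eval x (splitForm b v i) ≤ eval x (splitForm b v l) := by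
  have hconv : Convex ℝ
      (((b.coord i v)⁻¹ • b.coord i - (b.coord l v)⁻¹ • b.coord l : (Fin n → ℝ) →ᵃ[ℝ] ℝ) ⁻¹'
        Set.Iic 0) := (convex_Iic 0).affine_preimage _
  have hsub : {v} ∪ b '' {j | j ≠ i} ⊆
      (((b.coord i v)⁻¹ • b.coord i - (b.coord l v)⁻¹ • b.coord l : (Fin n → ℝ) →ᵃ[ℝ] ℝ) ⁻¹'
        Set.Iic 0) := by
    rintro y (rfl | ⟨j, hj, rfl⟩)
    · simp [(hv i).ne', (hv l).ne']
    · have h1 : 0 ≤ b.coord l (b j) := by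
        rw [b.coord_apply]
        split_ifs <;> norm_num
      have h2 : 0 ≤ (b.coord l v)⁻¹ * b.coord l (b j) :=
        mul_nonneg (inv_nonneg.2 (hv l).le) h1
      simpa [b.coord_apply_ne (Ne.symm hj)] using h2
  have := convexHull_min hsub hconv hx
  rw [eval_splitForm, eval_splitForm]
  simpa using this

theorem mem_alfeldCell_of_splitForm_le (hv : ∀ l, 0 < b.coord l v) {i : Fin (n + 1)}
    {x : Fin n → ℝ} (hx : x ∈ convexHull ℝ (Set.range b))
    (h : ∀ l, eval x (splitForm b v i) ≤ eval x (splitForm b v l)) : x ∈ alfeldCell b v i := by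
  rw [b.convexHull_eq_nonneg_coord] at hx
  simp only [eval_splitForm] at h
  set t := (b.coord i v)⁻¹ * b.coord i x with ht
  have hti : b.coord i x - t * b.coord i v = 0 := by
    have := (hv i).ne'
    rw [ht]
    field_simp
    ring
  have hz : ∀ {M : Type} [AddCommGroup M] [Module ℝ M] (z : Fin (n + 1) → M) (z' : M),
      ∑ l, (if l = i then t else b.coord l x - t * b.coord l v) • (if l = i then z' else z l) =
        t • z' + ∑ l, (b.coord l x - t * b.coord l v) • z l := by
    intro M _ _ z z'
    rw [← Finset.add_sum_erase _ _ (Finset.mem_univ i), ← Finset.add_sum_erase (a := i) _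
      (fun l => (b.coord l x - t * b.coord l v) • z l) (Finset.mem_univ i), hti]
    simp only [if_true, zero_smul, zero_add]
    congr 1
    refine Finset.sum_congr rfl fun l hl => ?_
    rw [if_neg (Finset.ne_of_mem_erase hl), if_neg (Finset.ne_of_mem_erase hl)]
  have hsum : ∑ l, (if l = i then t else b.coord l x - t * b.coord l v) = 1 := by
    have := hz (fun _ => (1 : ℝ)) 1
    simp only [ite_self, smul_eq_mul, mul_one, Finset.sum_sub_distrib, ← Finset.mul_sum,
      b.sum_coord_apply_eq_one] at this
    linarith
  have hcomb : ∑ l, (if l = i then t else b.coord l x - t * b.coord l v) •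
      (if l = i then v else b l) = x := by
    rw [hz]
    simp only [sub_smul, Finset.sum_sub_distrib, mul_smul, ← Finset.smul_sum,
      b.linear_combination_coord_eq_self]
    abel
  rw [← hcomb]
  refine (convex_convexHull ℝ _).sum_mem (fun l _ => ?_) hsum fun l _ => subset_convexHull ℝ _ ?_
  · split_ifs with hl
    · exact mul_nonneg (inv_nonneg.2 (hv i).le) (hx i)
    · have h1 := mul_le_mul_of_nonneg_right (h l) (hv l).le
      have h2 := (hv l).ne'
      have h3 : (b.coord l v)⁻¹ * b.coord l x * b.coord l v = b.coord l x := by field_simp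
      linarith
  · split_ifs with hl
    · exact Or.inl rfl
    · exact Or.inr ⟨l, hl, rfl⟩

theorem mem_interior_of_splitForm_pos (hv : ∀ l, 0 < b.coord l v) {x : Fin n → ℝ}
    (h : ∀ l, 0 < eval x (splitForm b v l)) : x ∈ interior (convexHull ℝ (Set.range b)) := by
  rw [b.interior_convexHull]
  intro l
  have := h l
  rw [eval_splitForm] at this
  exact pos_of_mul_pos_right this (inv_pos.2 (hv l)).le

end SplitForms

section Splines

variable {n : ℕ} {L : Fin (n + 1) → MvPolynomial (Fin n) ℝ} {s k : ℕ}

/-- The coefficients of a spline of degree at most `k` with respect to the constant vector and the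
vectors `integralBasis L s · a`. -/
abbrev SplineCoefficients (n s k : ℕ) : Type :=
  restrictTotalDegree (Fin n) ℝ k ×
    ((a : Fin n) → restrictShiftedDegree n k (s * (n + 1) + ((a : ℕ) + 1)))

/-- The `i`-th polynomial piece of the spline with given coefficients. -/
def splinePiece (L : Fin (n + 1) → MvPolynomial (Fin n) ℝ) (s k : ℕ) (i : Fin (n + 1)) :
    SplineCoefficients n s k →ₗ[ℝ] MvPolynomial (Fin n) ℝ where
  toFun z := (z.1 : MvPolynomial (Fin n) ℝ) +
    ∑ a, (z.2 a : MvPolynomial (Fin n) ℝ) * integralBasis L s i a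
  map_add' z z' := by
    simp only [Prod.fst_add, Prod.snd_add, Submodule.coe_add, Pi.add_apply, add_mul,
      Finset.sum_add_distrib]
    abel
  map_smul' c z := by
    simp only [Prod.smul_fst, Prod.smul_snd, Submodule.coe_smul, Pi.smul_apply, smul_mul_assoc,
      ← Finset.smul_sum, smul_add, RingHom.id_apply]

theorem splinePiece_apply (i : Fin (n + 1)) (z : SplineCoefficients n s k) :
    splinePiece L s k i z = (z.1 : MvPolynomial (Fin n) ℝ) +
      ∑ a, (z.2 a : MvPolynomial (Fin n) ℝ) * integralBasis L s i a := rfl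

theorem splinePiece_zero (z : SplineCoefficients n s k) : splinePiece L s k 0 z = z.1 := by
  simp [splinePiece_apply, integralBasis_zero]

theorem pow_dvd_splinePiece_sub (z : SplineCoefficients n s k) (i j : Fin (n + 1)) :
    (L j - L i) ^ (2 * s + 1) ∣ splinePiece L s k j z - splinePiece L s k i z := by
  rw [splinePiece_apply, splinePiece_apply, add_sub_add_left_eq_sub, ← Finset.sum_sub_distrib]
  refine Finset.dvd_sum fun a _ => ?_
  rw [← mul_sub]
  exact (pow_dvd_integralBasis_sub s i j a).mul_left _

theorem totalDegree_splinePiece_le (hL : ∀ i, (L i).totalDegree ≤ 1) (i : Fin (n + 1))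
    (z : SplineCoefficients n s k) : (splinePiece L s k i z).totalDegree ≤ k := by
  rw [splinePiece_apply]
  refine (totalDegree_add _ _).trans (max_le ((mem_restrictTotalDegree _ _ _).1 z.1.2)
    (totalDegree_finsetSum_le fun a _ => ?_))
  by_cases h : (z.2 a : MvPolynomial (Fin n) ℝ) = 0
  · simp [h]
  · exact (totalDegree_mul _ _).trans ((Nat.add_le_add_left
      (totalDegree_integralBasis_le hL s i a) _).trans (mem_restrictShiftedDegree.1 (z.2 a).2 h))

theorem eq_zero_of_splinePiece_eq_zero (hL : IsBarycentricSystem L)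
    {z : SplineCoefficients n s k} (hz : ∀ i, splinePiece L s k i z = 0) : z = 0 := by
  have h0 : (z.1 : MvPolynomial (Fin n) ℝ) = 0 := by rw [← splinePiece_zero (L := L), hz]
  have h1 := Matrix.eq_zero_of_mulVec_eq_zero (det_integralBasis_ne_zero hL s)
    (v := fun a => (z.2 a : MvPolynomial (Fin n) ℝ)) <| by
      ext1 i
      have := hz i.succ
      rw [splinePiece_apply, h0, zero_add] at this
      simpa only [Matrix.mulVec, dotProduct, Matrix.of_apply, mul_comm, Pi.zero_apply] using this
  exact Prod.ext (Subtype.ext h0) (funext fun a => Subtype.ext (congrFun h1 a))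

theorem exists_splinePiece_eq (hL : IsBarycentricSystem L)
    {p : Fin (n + 1) → MvPolynomial (Fin n) ℝ} (hk : ∀ i, (p i).totalDegree ≤ k)
    (hp : ∀ i j, (L j - L i) ^ (2 * s + 1) ∣ p j - p i) :
    ∃ z, ∀ i, splinePiece L s k i z = p i := by
  obtain ⟨g, hg, hpg⟩ := hL.exists_eq_sum_mul (2 * s + 1) (integralBasis_zero s)
    (pow_dvd_integralBasis_sub s) (det_integralBasis_ne_zero hL s)
    (totalDegree_integralBasis_le hL.totalDegree_le s) (sum_integralBasis_degree s)
    (H := fun i => p i - p 0) (sub_self _) (fun i j => by simpa using hp i j) (k := k)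
    (fun i => (MvPolynomial.totalDegree_sub _ _).trans (max_le (hk i) (hk 0)))
  refine ⟨(⟨p 0, (mem_restrictTotalDegree _ _ _).2 (hk 0)⟩, fun a => ⟨g a, hg a⟩), fun i => ?_⟩
  rw [splinePiece_apply, eq_comm, ← sub_eq_iff_eq_add', hpg]

theorem finrank_splineCoefficients (hn : 1 ≤ n) (s k : ℕ) :
    Module.finrank ℝ (SplineCoefficients n s k) =
      (k + n).choose n + ∑ j ∈ Finset.Icc 1 n, (k + n - j - s * (n + 1)).choose n := by
  have hfin : Module.Finite ℝ (restrictTotalDegree (Fin n) ℝ k) := inferInstance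
  rw [Module.finrank_prod, finrank_restrictTotalDegree, Module.finrank_pi_fintype,
    ← Finset.Ico_add_one_right_eq_Icc, Finset.sum_Ico_eq_sum_range, Nat.add_sub_cancel,
    ← Fin.sum_univ_eq_sum_range (fun j => (k + n - (1 + j) - s * (n + 1)).choose n)]
  congr 1
  refine Finset.sum_congr rfl fun a _ => ?_
  rw [finrank_restrictShiftedDegree hn, Nat.sub_sub]
  congr 2
  ring

/-- The spline with given coefficients, as a function on the simplex, where `c` chooses for each
point a piece containing it. -/
def splineMap (L : Fin (n + 1) → MvPolynomial (Fin n) ℝ) (s k : ℕ) (S : Set (Fin n → ℝ))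
    (c : (Fin n → ℝ) → Fin (n + 1)) : SplineCoefficients n s k →ₗ[ℝ] (S → ℝ) where
  toFun z x := eval (x : Fin n → ℝ) (splinePiece L s k (c x) z)
  map_add' z z' := by ext x; simp
  map_smul' t z := by ext x; simp [smul_eval]

theorem splineMap_injective (hL : IsBarycentricSystem L) {S : Set (Fin n → ℝ)}
    (hS : ∀ x, (∀ l, 0 < eval x (L l)) → x ∈ S) {c : (Fin n → ℝ) → Fin (n + 1)}
    (hc : ∀ x l, eval x (L (c x)) ≤ eval x (L l)) :
    Function.Injective (splineMap L s k S c) := by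
  refine (injective_iff_map_eq_zero _).2 fun z hz =>
    eq_zero_of_splinePiece_eq_zero hL fun i => hL.eq_zero_of_eval_eq_zero i fun x hx hi => ?_
  rw [← (contDiff_eval_of_pow_dvd (pow_dvd_splinePiece_sub z) hc).1 i x hi]
  exact congrFun hz ⟨x, hS x hx⟩

theorem range_splineMap {b : AffineBasis (Fin (n + 1)) ℝ (Fin n → ℝ)} {v : Fin n → ℝ}
    (hv : ∀ l, 0 < b.coord l v) {c : (Fin n → ℝ) → Fin (n + 1)}
    (hc : ∀ x l, eval x (splitForm b v (c x)) ≤ eval x (splitForm b v l)) :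
    LinearMap.range (splineMap (splitForm b v) s k (convexHull ℝ (Set.range b)) c) =
      alfeldSplines n (2 * s) k b v := by
  have hL := isBarycentricSystem_splitForm hv
  ext f
  constructor
  · rintro ⟨z, rfl⟩
    obtain ⟨heq, hF⟩ := contDiff_eval_of_pow_dvd (pow_dvd_splinePiece_sub z) hc
    exact ⟨_, hF.contDiffOn, fun x => rfl, fun i => ⟨splinePiece _ s k i z,
      totalDegree_splinePiece_le hL.totalDegree_le i z,
      fun x hx => heq i x (splitForm_le_of_mem_alfeldCell hv hx)⟩⟩
  · rintro ⟨F, hF, hfF, hFp⟩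
    choose p hk hp using hFp
    have hmem : ∀ x, (∀ l, 0 < eval x (splitForm b v l)) →
        convexHull ℝ (Set.range b) ∈ nhds x := fun x hx =>
      mem_interior_iff_mem_nhds.1 (mem_interior_of_splitForm_pos hv hx)
    obtain ⟨z, hz⟩ := exists_splinePiece_eq hL hk <|
      hL.pow_dvd_of_contDiffAt (fun x hx => hF.contDiffAt (hmem x hx)) fun i x hx hi =>
        hp i x (mem_alfeldCell_of_splitForm_le hv (mem_of_mem_nhds (hmem x hx)) hi)
    refine ⟨z, funext fun x => ?_⟩
    rw [hfF, hp _ _ (mem_alfeldCell_of_splitForm_le hv x.2 (hc x)), ← hz]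
    rfl

end Splines

/-- **Conjecture of Foucart–Sorokina, even case** (proved by Schenck): for `r` even, the
dimension of `C^r_k(AS(Δ_n))` is `binom(k+n, n) + Σ_{j=1}^{n} binom(k + n - j - r(n+1)/2, n)`
(where, thanks to truncated subtraction, `binom(a, n) = 0` whenever the corresponding integer
is less than `n`). -/
theorem dim_alfeldSplines_even (n r k : ℕ) (hn : 1 ≤ n) (hr : Even r)
    (e : Fin (n + 1) → Fin n → ℝ) (he : AffineIndependent ℝ e)
    (v : Fin n → ℝ) (hv : v ∈ interior (convexHull ℝ (Set.range e))) :
    Module.finrank ℝ (alfeldSplines n r k e v) =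
      (k + n).choose n + ∑ j ∈ Finset.Icc 1 n, ((k + n - j - r * (n + 1) / 2).choose n) := by
  obtain ⟨s, rfl⟩ := hr
  rw [← two_mul, show 2 * s * (n + 1) / 2 = s * (n + 1) by rw [mul_assoc]; simp]
  set b : AffineBasis (Fin (n + 1)) ℝ (Fin n → ℝ) :=
    ⟨e, he, he.affineSpan_eq_top_iff_card_eq_finrank_add_one.2 (by simp)⟩ with hb
  change v ∈ interior (convexHull ℝ (Set.range b)) at hv
  change Module.finrank ℝ (alfeldSplines n (2 * s) k b v) = _
  rw [b.interior_convexHull] at hv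
  choose c hc using fun x : Fin n → ℝ => Finite.exists_min fun l => eval x (splitForm b v l)
  rw [← range_splineMap hv hc, LinearMap.finrank_range_of_inj, finrank_splineCoefficients hn]
  exact splineMap_injective (isBarycentricSystem_splitForm hv)
    (fun x hx => interior_subset (mem_interior_of_splitForm_pos hv hx)) hc

end
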